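/- arXiv:2104.11049 — 2 statements merged into one kernel-verified Lean document; each statement's English description precedes it below -/
import Mathlib

section
/- (Lemma 2.) Let N ≥ 1 and m, q : ℕ → ℂ. The following are equivalent: (a) there exist monic degree-N polynomials P, R ∈ ℂ[z] and a polynomial Q ∈ ℂ[z] of degree ≤ N−1 such that P and R are coprime in ℂ[z], Q and P+R are coprime in ℂ[z], and both identities R̂ − P̂ = (R̂ + P̂) · Σ_{k≥0} m_k t^{k+1} and 2Q̂ = (R̂ + P̂) · Σ_{k≥0} q_k t^{k+1} hold in ℂ[[t]]; (b) det L_N(m) ≠ 0, det L_N(q) ≠ 0, det L_n(m) = 0 and det L_n(q) = 0 for every n > N, and det L_N(q) · det Ĉ_l(m) = det L_N(m) · det Ĉ_l(q) for every 1 ≤ l ≤ N. -/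
open Polynomial Finset

/-- The formal power series `Σ_{k≥0} m_k t^{k+1}`. -/
noncomputable def tailSeries (m : ℕ → ℂ) : PowerSeries ℂ :=
  PowerSeries.mk fun n => if n = 0 then 0 else m (n - 1)

/-- The `i × i` matrix `L_i(m)` whose 1-indexed `(j,k)` entry is `m_{(i-j)+(k-1)}`. -/
def Lmat (i : ℕ) (m : ℕ → ℂ) : Matrix (Fin i) (Fin i) ℂ :=
  Matrix.of fun j k => m ((i - 1 - (j : ℕ)) + (k : ℕ))

/-- The `(N+1) × (N+1)` matrix `Ĉ_l(m)`: first row `(0, m_N, …, m_{2N-1})`, first column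
with a single `1` in (1-indexed) row `l+1`, and lower-right `N × N` block `L_N(m)`. -/
def Chat (N l : ℕ) (m : ℕ → ℂ) : Matrix (Fin (N + 1)) (Fin (N + 1)) ℂ :=
  Matrix.of fun j k =>
    if (j : ℕ) = 0 then (if (k : ℕ) = 0 then 0 else m (N + ((k : ℕ) - 1)))
    else if (k : ℕ) = 0 then (if (j : ℕ) = l then 1 else 0)
    else m ((N - (j : ℕ)) + ((k : ℕ) - 1))

/-- The linear functional on polynomials whose moments are `m`. -/
noncomputable def momentFunctional (m : ℕ → ℂ) : ℂ[X] →ₗ[ℂ] ℂ :=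
  Polynomial.lsum fun k => m k • LinearMap.id

lemma momentFunctional_C_mul_X_pow (m : ℕ → ℂ) (a : ℂ) (k : ℕ) :
    momentFunctional m (C a * X ^ k) = m k * a := by
  simp [momentFunctional, Polynomial.lsum_apply, C_mul_X_pow_eq_monomial, sum_monomial_index]

/-- The polynomial with coefficient vector `v`. -/
noncomputable def vecPoly {n : ℕ} (v : Fin n → ℂ) : ℂ[X] :=
  ∑ i : Fin n, C (v i) * X ^ (i : ℕ)

lemma degree_vecPoly_lt {n : ℕ} (v : Fin n → ℂ) : (vecPoly v).degree < n :=
  degree_sum_fin_lt v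

lemma coeff_vecPoly {n : ℕ} (v : Fin n → ℂ) (i : Fin n) : (vecPoly v).coeff i = v i := by
  simp [vecPoly, coeff_C_mul, coeff_X_pow, Fin.val_inj]

lemma vecPoly_coeff {n : ℕ} {f : ℂ[X]} (hf : f.degree < n) :
    vecPoly (fun i : Fin n => f.coeff i) = f := by
  rw [vecPoly, Fin.sum_univ_eq_sum_range (fun i => C (f.coeff i) * X ^ i) n]
  by_cases h0 : f = 0
  · simp [h0]
  · exact (f.as_sum_range_C_mul_X_pow' ((natDegree_lt_iff_degree_lt h0).2 hf)).symm

lemma momentFunctional_vecPoly_mul_X_pow (m : ℕ → ℂ) {n : ℕ} (v : Fin n → ℂ) (k : ℕ) :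
    momentFunctional m (vecPoly v * X ^ k) = ∑ i : Fin n, m (k + i) * v i := by
  rw [vecPoly, Finset.sum_mul, map_sum]
  refine Finset.sum_congr rfl fun i _ => ?_
  rw [mul_assoc, ← pow_add, momentFunctional_C_mul_X_pow, add_comm]

lemma momentFunctional_mul_eq_zero {m : ℕ → ℂ} {n : ℕ} {f g : ℂ[X]}
    (hf : ∀ k < n, momentFunctional m (f * X ^ k) = 0) (hg : g.degree < n) :
    momentFunctional m (f * g) = 0 := by
  rw [← vecPoly_coeff hg, vecPoly, Finset.mul_sum, map_sum]
  refine Finset.sum_eq_zero fun i _ => ?_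
  rw [mul_left_comm, ← smul_eq_C_mul, map_smul, hf i i.2, smul_zero]

lemma momentFunctional_mul_eq_zero_of_forall {m : ℕ → ℂ} {f : ℂ[X]}
    (hf : ∀ k, momentFunctional m (f * X ^ k) = 0) (g : ℂ[X]) :
    momentFunctional m (f * g) = 0 :=
  momentFunctional_mul_eq_zero (n := g.natDegree + 1) (fun k _ => hf k)
    (degree_le_natDegree.trans_lt (by exact_mod_cast Nat.lt_succ_self _))

lemma Lmat_mulVec (m : ℕ → ℂ) {n : ℕ} (v : Fin n → ℂ) (j : Fin n) :
    (Lmat n m).mulVec v j = momentFunctional m (vecPoly v * X ^ (n - 1 - (j : ℕ))) := by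
  rw [momentFunctional_vecPoly_mul_X_pow]
  rfl

lemma det_Lmat_eq_zero_iff {m : ℕ → ℂ} {n : ℕ} :
    (Lmat n m).det = 0 ↔ ∃ f : ℂ[X], f ≠ 0 ∧ f.degree < n ∧
      ∀ k < n, momentFunctional m (f * X ^ k) = 0 := by
  rw [← Matrix.exists_mulVec_eq_zero_iff]
  constructor
  · rintro ⟨v, hv, h⟩
    refine ⟨vecPoly v, ?_, degree_vecPoly_lt v, fun k hk => ?_⟩
    · contrapose! hv
      ext i
      rw [← coeff_vecPoly v i, hv, coeff_zero, Pi.zero_apply]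
    · have := congrFun h ⟨n - 1 - k, by omega⟩
      rw [Lmat_mulVec] at this
      simpa [show n - 1 - (n - 1 - k) = k by omega] using this
  · rintro ⟨f, hf0, hf, h⟩
    refine ⟨fun i => f.coeff i, ?_, ?_⟩
    · contrapose! hf0
      rw [← vecPoly_coeff hf, hf0]
      simp [vecPoly]
    · ext j
      rw [Lmat_mulVec, vecPoly_coeff hf]
      exact h _ (by omega)

lemma exists_monic_momentFunctional_eq_zero {m : ℕ → ℂ} {N : ℕ} (hm : (Lmat N m).det ≠ 0) :
    ∃ D : ℂ[X], D.Monic ∧ D.natDegree = N ∧ ∀ k < N, momentFunctional m (D * X ^ k) = 0 := by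
  have hu : IsUnit (Lmat N m) := (Matrix.isUnit_iff_isUnit_det _).2 hm.isUnit
  obtain ⟨v, hv⟩ := Matrix.mulVec_surjective_iff_isUnit.2 hu
    (fun j : Fin N => -m (N + (N - 1 - (j : ℕ))))
  refine ⟨X ^ N + vecPoly v, monic_X_pow_add (degree_vecPoly_lt v),
    (natDegree_add_eq_left_of_degree_lt
      (by simpa using degree_vecPoly_lt v)).trans (natDegree_X_pow N), fun k hk => ?_⟩
  have := congrFun hv ⟨N - 1 - k, by omega⟩
  rw [Lmat_mulVec] at this
  simp only [show N - 1 - (N - 1 - k) = k by omega] at this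
  have hX : momentFunctional m (X ^ N * X ^ k) = m (N + k) := by
    simpa [pow_add] using momentFunctional_C_mul_X_pow m 1 (N + k)
  rw [add_mul, map_add, this, hX, add_neg_cancel]

/-- Kronecker's theorem: vanishing of all large Hankel determinants forces a linear recurrence. -/
lemma exists_monic_annihilator {m : ℕ → ℂ} {N : ℕ} (hm : (Lmat N m).det ≠ 0)
    (h : ∀ n, N < n → (Lmat n m).det = 0) :
    ∃ D : ℂ[X], D.Monic ∧ D.natDegree = N ∧ ∀ k, momentFunctional m (D * X ^ k) = 0 := by
  obtain ⟨D, hD, hdeg, hk⟩ := exists_monic_momentFunctional_eq_zero hm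
  refine ⟨D, hD, hdeg, fun n => ?_⟩
  induction n using Nat.strong_induction_on with
  | _ n ih =>
  by_cases hn : n < N
  · exact hk n hn
  obtain ⟨f, hf0, hf, hfk⟩ := det_Lmat_eq_zero_iff.1 (h (n + 1) (by omega))
  have hDdeg : D.degree = N := by rw [degree_eq_natDegree hD.ne_zero, hdeg]
  have hdiv : f %ₘ D + D * (f /ₘ D) = f := modByMonic_add_div f D
  set u := f /ₘ D with hu
  have hfn : f.natDegree ≤ n := by
    have := (natDegree_lt_iff_degree_lt hf0).2 hf
    omega
  have hun : u.natDegree + N ≤ n := by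
    rw [hu, natDegree_divByMonic f hD]
    omega
  have hr : f %ₘ D = 0 := by
    by_contra hr
    refine hm (det_Lmat_eq_zero_iff.2 ⟨f %ₘ D, hr, hDdeg ▸ degree_modByMonic_lt f hD, ?_⟩)
    intro k hkN
    have h1 : momentFunctional m (D * (u * X ^ k)) = 0 := by
      refine momentFunctional_mul_eq_zero (n := n) ih ?_
      refine degree_le_natDegree.trans_lt ?_
      have := natDegree_mul_le (p := u) (q := (X : ℂ[X]) ^ k)
      rw [natDegree_X_pow] at this
      exact_mod_cast (by omega : (u * X ^ k).natDegree < n)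
    have h2 := hfk k (by omega)
    rw [← hdiv, add_mul, map_add, mul_assoc, h1, add_zero] at h2
    exact h2
  rw [hr, zero_add] at hdiv
  have hu0 : u ≠ 0 := by
    rintro h0
    rw [h0, mul_zero] at hdiv
    exact hf0 hdiv.symm
  set g := u * X ^ (n - u.natDegree) with hg
  have hgdeg : g.natDegree = n := by
    rw [hg, natDegree_mul_X_pow _ hu0]
    omega
  have hg0 : g ≠ 0 := mul_ne_zero hu0 (pow_ne_zero _ X_ne_zero)
  have h1 : momentFunctional m (D * g) = 0 := by
    rw [hg, ← mul_assoc, hdiv]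
    exact hfk _ (by omega)
  have h2 : momentFunctional m (D * g.eraseLead) = 0 := by
    refine momentFunctional_mul_eq_zero (n := n) ih ?_
    rw [← hgdeg, ← degree_eq_natDegree hg0]
    exact degree_eraseLead_lt hg0
  rw [← eraseLead_add_C_mul_X_pow g, mul_add, map_add, h2, zero_add, hgdeg, mul_left_comm,
    ← smul_eq_C_mul, map_smul, smul_eq_mul] at h1
  exact (mul_eq_zero.1 h1).resolve_left (leadingCoeff_ne_zero.2 hg0)

lemma coeff_reflect_mul_tailSeries (m : ℕ → ℂ) {N : ℕ} {D : ℂ[X]} (hD : D.natDegree ≤ N) (k : ℕ) :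
    PowerSeries.coeff (N + 1 + k) ((reflect N D : PowerSeries ℂ) * tailSeries m) =
      momentFunctional m (D * X ^ k) := by
  refine induction_with_natDegree_le (fun D => PowerSeries.coeff (N + 1 + k)
    ((reflect N D : PowerSeries ℂ) * tailSeries m) = momentFunctional m (D * X ^ k)) N ?_ ?_ ?_ D hD
  · simp
  · intro i a _ hi
    rw [reflect_C_mul_X_pow, revAt_le hi, mul_assoc, ← pow_add, momentFunctional_C_mul_X_pow,
      Polynomial.coe_mul, coe_C, Polynomial.coe_pow, coe_X, mul_assoc, PowerSeries.coeff_C_mul,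
      PowerSeries.coeff_X_pow_mul', if_pos (by omega), tailSeries, PowerSeries.coeff_mk,
      if_neg (by omega), mul_comm]
    congr 2
    omega
  · intro f g _ _ hf hg
    rw [reflect_add, Polynomial.coe_add, add_mul, map_add, hf, hg, add_mul, map_add]

lemma momentFunctional_eq_zero_of_reflect_eq {m : ℕ → ℂ} {N : ℕ} {A D : ℂ[X]}
    (hD : D.natDegree ≤ N) (hA : A.natDegree ≤ N)
    (h : (reflect N A : PowerSeries ℂ) = (reflect N D : PowerSeries ℂ) * tailSeries m) (k : ℕ) :
    momentFunctional m (D * X ^ k) = 0 := by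
  rw [← coeff_reflect_mul_tailSeries m hD, ← h, coeff_coe, coeff_reflect,
    revAt_eq_self_of_lt (by omega)]
  exact coeff_eq_zero_of_natDegree_lt (by omega)

lemma exists_reflect_eq {m : ℕ → ℂ} {N : ℕ} {D : ℂ[X]} (hD : D.natDegree ≤ N)
    (h : ∀ k, momentFunctional m (D * X ^ k) = 0) :
    ∃ A : ℂ[X], A.degree < N ∧
      (reflect N A : PowerSeries ℂ) = (reflect N D : PowerSeries ℂ) * tailSeries m := by
  set S := (reflect N D : PowerSeries ℂ) * tailSeries m with hS
  refine ⟨reflect N (PowerSeries.trunc (N + 1) S), ?_, ?_⟩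
  · rw [degree_lt_iff_coeff_zero]
    intro i hi
    rw [coeff_reflect, PowerSeries.coeff_trunc]
    rcases hi.eq_or_lt with rfl | hi
    · rw [revAt_le le_rfl, Nat.sub_self, if_pos (by omega), PowerSeries.coeff_zero_eq_constantCoeff,
        hS, map_mul]
      simp [tailSeries]
    · rw [revAt_eq_self_of_lt hi, if_neg (by omega)]
  · ext i
    rw [reflect_reflect, coeff_coe, PowerSeries.coeff_trunc]
    split_ifs with hi
    · rfl
    · obtain ⟨k, rfl⟩ := Nat.exists_eq_add_of_le (not_lt.1 hi)
      rw [hS, coeff_reflect_mul_tailSeries m hD, h k]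

lemma coe_reflect_ne_zero {N : ℕ} {f : ℂ[X]} (hf : f ≠ 0) :
    (reflect N f : PowerSeries ℂ) ≠ 0 := by
  rw [Ne, coe_eq_zero_iff, reflect_eq_zero_iff]
  exact hf

lemma det_Lmat_ne_zero_of_isCoprime {m : ℕ → ℂ} {N : ℕ} {A D : ℂ[X]} (hD : D.Monic)
    (hdeg : D.natDegree = N) (hA : A.natDegree ≤ N) (hcop : IsCoprime A D)
    (h : (reflect N A : PowerSeries ℂ) = (reflect N D : PowerSeries ℂ) * tailSeries m) :
    (Lmat N m).det ≠ 0 := by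
  intro hdet
  obtain ⟨f, hf0, hf, hfk⟩ := det_Lmat_eq_zero_iff.1 hdet
  have hDdeg : D.degree = N := by rw [degree_eq_natDegree hD.ne_zero, hdeg]
  have hDk := momentFunctional_eq_zero_of_reflect_eq hdeg.le hA h
  have hfall : ∀ k, momentFunctional m (f * X ^ k) = 0 := by
    intro k
    rw [← modByMonic_add_div (X ^ k) D, mul_add, map_add, mul_left_comm f,
      momentFunctional_mul_eq_zero_of_forall hDk, add_zero]
    exact momentFunctional_mul_eq_zero hfk (hDdeg ▸ degree_modByMonic_lt _ hD)
  have hfN := (natDegree_lt_iff_degree_lt hf0).2 hf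
  obtain ⟨B, hB, hfB⟩ := exists_reflect_eq hfN.le hfall
  have hBN : B.natDegree ≤ N := natDegree_le_of_degree_le hB.le
  have key : D * B = f * A := by
    have : reflect (N + N) (D * B) = reflect (N + N) (f * A) := by
      rw [reflect_mul _ _ hdeg.le hBN, reflect_mul _ _ hfN.le hA]
      apply Polynomial.coe_injective ℂ
      rw [Polynomial.coe_mul, Polynomial.coe_mul, h, hfB]
      ring
    rw [← reflect_reflect (N := N + N) (p := D * B), this, reflect_reflect]
  have hdvd : D ∣ f := hcop.symm.dvd_of_dvd_mul_right ⟨B, key.symm⟩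
  have := natDegree_le_of_dvd hdvd hf0
  omega

lemma isCoprime_of_det_Lmat_ne_zero {m : ℕ → ℂ} {N : ℕ} {A D : ℂ[X]} (hD : D.Monic)
    (hdeg : D.natDegree = N) (hA : A.natDegree ≤ N)
    (h : (reflect N A : PowerSeries ℂ) = (reflect N D : PowerSeries ℂ) * tailSeries m)
    (hdet : (Lmat N m).det ≠ 0) : IsCoprime A D := by
  refine isCoprime_of_dvd _ _ (fun h0 => hD.ne_zero h0.2) ?_
  rintro g hgu hg0 ⟨A', rfl⟩ ⟨D', rfl⟩
  have hD'0 : D' ≠ 0 := right_ne_zero_of_mul hD.ne_zero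
  have hgdeg : g.natDegree ≠ 0 := fun hg =>
    hgu (isUnit_iff_degree_eq_zero.2 (by rw [degree_eq_natDegree hg0, hg]; rfl))
  rw [natDegree_mul hg0 hD'0] at hdeg
  have hA' : A'.natDegree ≤ D'.natDegree := by
    by_cases hA0 : A' = 0
    · simp [hA0]
    · rw [natDegree_mul hg0 hA0] at hA
      omega
  subst hdeg
  rw [reflect_mul _ _ le_rfl hA', reflect_mul _ _ le_rfl le_rfl, Polynomial.coe_mul, Polynomial.coe_mul, mul_assoc] at h
  have hk := momentFunctional_eq_zero_of_reflect_eq le_rfl hA'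
    (mul_left_cancel₀ (coe_reflect_ne_zero hg0) h)
  refine hdet (det_Lmat_eq_zero_iff.2 ⟨D', hD'0, ?_, fun k _ => hk k⟩)
  rw [degree_eq_natDegree hD'0]
  exact_mod_cast (by omega : D'.natDegree < g.natDegree + D'.natDegree)

lemma det_Lmat_eq_zero_of_annihilator {m : ℕ → ℂ} {n : ℕ} {D : ℂ[X]} (hD : D ≠ 0)
    (hn : D.natDegree < n) (h : ∀ k, momentFunctional m (D * X ^ k) = 0) :
    (Lmat n m).det = 0 :=
  det_Lmat_eq_zero_iff.2 ⟨D, hD, (natDegree_lt_iff_degree_lt hD).1 hn, fun k _ => h k⟩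

lemma det_Chat {m : ℕ → ℂ} {N l : ℕ} {D : ℂ[X]} (hD : D.Monic) (hdeg : D.natDegree = N)
    (h : ∀ k, momentFunctional m (D * X ^ k) = 0) (h1 : 1 ≤ l) (hl : l ≤ N) :
    (Chat N l m).det = D.coeff (N - l) * (Lmat N m).det := by
  have hrec : ∀ k, ∑ i ∈ range (N + 1), m (N - i + k) * D.coeff (N - i) = 0 := by
    intro k
    have hDlt : D.degree < (N + 1 : ℕ) := by
      rw [degree_eq_natDegree hD.ne_zero, hdeg]
      exact_mod_cast Nat.lt_succ_self N
    rw [← h k, ← vecPoly_coeff hDlt, momentFunctional_vecPoly_mul_X_pow, vecPoly_coeff hDlt,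
      Fin.sum_univ_eq_sum_range (fun i => m (k + i) * D.coeff i), ← Finset.sum_range_reflect]
    refine Finset.sum_congr rfl fun i hi => ?_
    have hi' : N - (N - i) = i := by
      rw [Finset.mem_range] at hi
      omega
    simp [hi', add_comm]
  have hupd := Matrix.det_updateRow_sum (Chat N l m) 0 fun j => D.coeff (N - (j : ℕ))
  have hlead : D.coeff N = 1 := by rw [← hdeg]; exact hD
  have hrow : ∑ j : Fin (N + 1), D.coeff (N - (j : ℕ)) • Chat N l m j =
      Fin.cons (D.coeff (N - l)) 0 := by
    ext k
    rw [Finset.sum_apply]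
    refine Fin.cases ?_ (fun k => ?_) k
    · rw [Finset.sum_eq_single ⟨l, by omega⟩]
      · simp [Chat, show l ≠ 0 by omega]
      · intro j _ hj
        have : (j : ℕ) ≠ l := fun hjl => hj (Fin.ext hjl)
        simp [Chat, this]
      · simp
    · rw [Fin.cons_succ, Pi.zero_apply, ← hrec k,
        ← Fin.sum_univ_eq_sum_range (fun i => m (N - i + k) * D.coeff (N - i))]
      refine Finset.sum_congr rfl fun j _ => ?_
      by_cases hj : (j : ℕ) = 0
      · simp [Chat, hj, mul_comm]
      · simp only [Pi.smul_apply, Chat, Matrix.of_apply, hj, if_false, Fin.val_succ, smul_eq_mul,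
          Nat.succ_ne_zero, Nat.add_sub_cancel, mul_comm]
  simp only [Fin.val_zero, Nat.sub_zero, hlead, one_smul] at hupd
  rw [← hupd, hrow, Matrix.det_succ_row_zero, Fin.sum_univ_succ]
  have hsub : ((Chat N l m).updateRow 0 (Fin.cons (D.coeff (N - l)) 0)).submatrix Fin.succ
      (Fin.succAbove 0) = Lmat N m := by
    ext i j
    simp only [Matrix.submatrix_apply, Matrix.updateRow_ne (Fin.succ_ne_zero i), Chat, Lmat,
      Matrix.of_apply, Fin.succAbove_zero, Fin.val_succ, Nat.succ_ne_zero, if_false]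
    congr 1
    omega
  rw [hsub]
  simp

/-- Lemma 2. -/
theorem stmt7 (N : ℕ) (hN : 1 ≤ N) (m q : ℕ → ℂ) :
    (∃ P R Q : Polynomial ℂ, P.Monic ∧ R.Monic ∧ P.natDegree = N ∧ R.natDegree = N ∧
        Q.degree ≤ ((N - 1 : ℕ) : WithBot ℕ) ∧
        IsCoprime P R ∧ IsCoprime Q (P + R) ∧
        (((reflect N R : Polynomial ℂ) : PowerSeries ℂ) - ((reflect N P : Polynomial ℂ) : PowerSeries ℂ)
          = (((reflect N R : Polynomial ℂ) : PowerSeries ℂ)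
              + ((reflect N P : Polynomial ℂ) : PowerSeries ℂ)) * tailSeries m) ∧
        ((2 : PowerSeries ℂ) * ((reflect N Q : Polynomial ℂ) : PowerSeries ℂ)
          = (((reflect N R : Polynomial ℂ) : PowerSeries ℂ)
              + ((reflect N P : Polynomial ℂ) : PowerSeries ℂ)) * tailSeries q))
      ↔ ((Lmat N m).det ≠ 0 ∧ (Lmat N q).det ≠ 0 ∧
         (∀ n, N < n → (Lmat n m).det = 0 ∧ (Lmat n q).det = 0) ∧
         (∀ l, 1 ≤ l → l ≤ N →
            (Lmat N q).det * (Chat N l m).det = (Lmat N m).det * (Chat N l q).det)) := by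
  constructor
  · rintro ⟨P, R, Q, hP, hR, hPN, hRN, hQ, hPR, hQPR, h1, h2⟩
    set D : ℂ[X] := C (1 / 2) * (P + R) with hDdef
    set A : ℂ[X] := C (1 / 2) * (R - P) with hAdef
    have h2C : (C (1 / 2) : ℂ[X]) * 2 = 1 := by
      rw [show (2 : ℂ[X]) = C 2 from rfl, ← C_mul]
      norm_num
    have hRe : R = D + A := by rw [hDdef, hAdef]; linear_combination -R * h2C
    have hPe : P = D - A := by rw [hDdef, hAdef]; linear_combination -P * h2C
    have hPRe : P + R = C 2 * D := by rw [hPe, hRe, show (C 2 : ℂ[X]) = 2 from rfl]; ring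
    have hPRlead : (P + R).coeff N = 2 := by
      have hPc : P.coeff N = 1 := by rw [← hPN]; exact hP
      have hRc : R.coeff N = 1 := by rw [← hRN]; exact hR
      rw [coeff_add, hPc, hRc]; norm_num
    have hDc : D.coeff N = 1 := by rw [hDdef, coeff_C_mul, hPRlead]; norm_num
    have hDle : D.natDegree ≤ N :=
      (natDegree_C_mul_le _ _).trans ((natDegree_add_le _ _).trans (by simp [hPN, hRN]))
    have hAle : A.natDegree ≤ N :=
      (natDegree_C_mul_le _ _).trans ((natDegree_sub_le _ _).trans (by simp [hPN, hRN]))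
    have hQle : Q.natDegree ≤ N := (natDegree_le_of_degree_le hQ).trans (Nat.sub_le _ _)
    have hD : D.Monic := monic_of_natDegree_le_of_coeff_eq_one N hDle hDc
    have hDN : D.natDegree = N :=
      le_antisymm hDle (le_natDegree_of_ne_zero (by rw [hDc]; exact one_ne_zero))
    have h2ne : (2 : PowerSeries ℂ) ≠ 0 := fun h0 => by
      have := congrArg PowerSeries.constantCoeff h0
      rw [map_ofNat, map_zero] at this
      exact two_ne_zero this
    have hA : (reflect N A : PowerSeries ℂ) = (reflect N D : PowerSeries ℂ) * tailSeries m := by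
      rw [hRe, hPe, sub_eq_add_neg D, reflect_add, reflect_add, reflect_neg] at h1
      push_cast at h1
      refine mul_left_cancel₀ h2ne ?_
      linear_combination h1
    have hQe : (reflect N Q : PowerSeries ℂ) = (reflect N D : PowerSeries ℂ) * tailSeries q := by
      rw [hRe, hPe, sub_eq_add_neg D, reflect_add, reflect_add, reflect_neg] at h2
      push_cast at h2
      refine mul_left_cancel₀ h2ne ?_
      linear_combination h2
    have hAD : IsCoprime A D := by
      obtain ⟨a, b, hab⟩ := hPR
      exact ⟨b - a, a + b, by rw [hPe, hRe] at hab; linear_combination hab⟩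
    have hQD : IsCoprime Q D := by
      rw [hPRe] at hQPR
      exact hQPR.of_mul_right_right
    have hm := momentFunctional_eq_zero_of_reflect_eq hDle hAle hA
    have hq := momentFunctional_eq_zero_of_reflect_eq hDle hQle hQe
    refine ⟨det_Lmat_ne_zero_of_isCoprime hD hDN hAle hAD hA,
      det_Lmat_ne_zero_of_isCoprime hD hDN hQle hQD hQe, fun n hn =>
      ⟨det_Lmat_eq_zero_of_annihilator hD.ne_zero (hDN ▸ hn) hm,
        det_Lmat_eq_zero_of_annihilator hD.ne_zero (hDN ▸ hn) hq⟩, fun l h1l hl => ?_⟩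
    rw [det_Chat hD hDN hm h1l hl, det_Chat hD hDN hq h1l hl]
    ring
  · rintro ⟨hm, hq, h0, hC⟩
    obtain ⟨D, hD, hDN, hDm⟩ := exists_monic_annihilator hm fun n hn => (h0 n hn).1
    obtain ⟨E, hE, hEN, hEq⟩ := exists_monic_annihilator hq fun n hn => (h0 n hn).2
    have hDE : E = D := by
      ext i
      rcases lt_trichotomy i N with hi | rfl | hi
      · have := hC (N - i) (by omega) (by omega)
        rw [det_Chat hD hDN hDm (by omega) (by omega), det_Chat hE hEN hEq (by omega) (by omega),
          show N - (N - i) = i by omega] at this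
        refine mul_left_cancel₀ (mul_ne_zero hm hq) ?_
        linear_combination -this
      · have hDc : D.coeff i = 1 := by rw [← hDN]; exact hD
        have hEc : E.coeff i = 1 := by rw [← hEN]; exact hE
        rw [hDc, hEc]
      · rw [coeff_eq_zero_of_natDegree_lt (by omega), coeff_eq_zero_of_natDegree_lt (by omega)]
    subst hDE
    obtain ⟨A, hAdeg, hA⟩ := exists_reflect_eq hDN.le hDm
    obtain ⟨Q, hQdeg, hQ⟩ := exists_reflect_eq hDN.le hEq
    have hAle : A.natDegree ≤ N := natDegree_le_of_degree_le hAdeg.le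
    have hQle : Q.natDegree ≤ N := natDegree_le_of_degree_le hQdeg.le
    have hAD := isCoprime_of_det_Lmat_ne_zero hD hDN hAle hA hm
    have hQD := isCoprime_of_det_Lmat_ne_zero hD hDN hQle hQ hq
    have hlt : A.degree < E.degree := by rwa [degree_eq_natDegree hD.ne_zero, hDN]
    have h2u : IsUnit (2 : ℂ[X]) := isUnit_C.2 (two_ne_zero (α := ℂ)).isUnit
    refine ⟨E - A, E + A, Q, hD.sub_of_left hlt, hD.add_of_left hlt, ?_, ?_, ?_, ?_, ?_, ?_, ?_⟩
    · rw [natDegree_eq_of_degree_eq (degree_sub_eq_left_of_degree_lt hlt), hDN]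
    · rw [natDegree_add_eq_left_of_degree_lt hlt, hDN]
    · rw [degree_le_iff_coeff_zero]
      intro i hi
      have hi' : N - 1 < i := by exact_mod_cast hi
      exact (degree_lt_iff_coeff_zero Q N).1 hQdeg i (by omega)
    · obtain ⟨a, b, hab⟩ := hAD
      have h2C : (C (1 / 2) : ℂ[X]) * 2 = 1 := by
        rw [show (2 : ℂ[X]) = C 2 from rfl, ← C_mul]
        norm_num
      exact ⟨C (1 / 2) * (b - a), C (1 / 2) * (a + b), by
        linear_combination hab + (a * A + b * E) * h2C⟩
    · rw [show E - A + (E + A) = 2 * E by ring]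
      exact (isCoprime_mul_unit_left_right h2u Q E).2 hQD
    · rw [sub_eq_add_neg E, reflect_add, reflect_add, reflect_neg]
      push_cast
      linear_combination 2 * hA
    · rw [sub_eq_add_neg E, reflect_add, reflect_add, reflect_neg]
      push_cast
      linear_combination 2 * hQ
end

section
/- Let M, a ∈ ℂ and define m_0 = M, m_1 = iaM, m_2 = −M(3a² + M²)/4, m_3 = −iaM(a² + M²)/2, m_4 = (5a⁴M + 10a²M³ + M⁵)/16, m_5 = i(3a⁵M + 10a³M³ + 3aM⁵)/16. Then det L_2(m) = m_1² − m_0 m_2 = (M⁴ − a²M²)/4. Moreover, if M²(M² − a²) ≠ 0, then for P(z) = z² − (M + ia)z + (M² − a²)/4 and R(z) = z² + (M − ia)z + (M² − a²)/4, the unique sequence m̃ : ℕ → ℂ with R̂ − P̂ = (R̂ + P̂)·Σ_{k≥0} m̃_k t^{k+1} in ℂ[[t]] satisfies m̃_k = m_k for all 0 ≤ k ≤ 5. (This recovers the axis Ernst potential of the Tomimatsu–Sato solution with δ = 2.) -/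
open Polynomial Finset

theorem reflect_two_quadratic (b c : ℂ) :
    reflect 2 (X ^ 2 + Polynomial.C b * X + Polynomial.C c)
      = 1 + Polynomial.C b * X + Polynomial.C c * X ^ 2 := by
  have h2 : reflect 2 (X ^ 2 : ℂ[X]) = 1 := by
    simp [revAt_le]
  have h1 : reflect 2 (Polynomial.C b * X) = Polynomial.C b * X := by
    simpa [revAt_le] using reflect_C_mul_X_pow 2 1 (c := b)
  have h0 : reflect 2 (Polynomial.C c) = Polynomial.C c * X ^ 2 := by
    simp
  rw [reflect_add, reflect_add, h2, h1, h0]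

theorem coeff_tailSeries_zero (m : ℕ → ℂ) : PowerSeries.coeff 0 (tailSeries m) = 0 := by
  simp [tailSeries]

theorem coeff_tailSeries_succ (m : ℕ → ℂ) (n : ℕ) :
    PowerSeries.coeff (n + 1) (tailSeries m) = m n := by
  simp [tailSeries]

/-- Initial values and linear recurrence of the coefficients of `M t / (1 + b t + c t ^ 2)`. -/
theorem tailSeries_recurrence {M b c : ℂ} {m : ℕ → ℂ}
    (h : PowerSeries.C M * PowerSeries.X
      = (1 + PowerSeries.C b * PowerSeries.X + PowerSeries.C c * PowerSeries.X ^ 2)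
        * tailSeries m) :
    m 0 = M ∧ m 1 = -b * m 0 ∧ ∀ n, m (n + 2) = -b * m (n + 1) - c * m n := by
  have hT : PowerSeries.C M * PowerSeries.X
      = tailSeries m + PowerSeries.C b * (PowerSeries.X * tailSeries m)
        + PowerSeries.C c * (PowerSeries.X * (PowerSeries.X * tailSeries m)) := by
    rw [h]; ring
  have hc := fun n => congrArg (PowerSeries.coeff n) hT
  refine ⟨?_, ?_, fun n => ?_⟩
  · have := hc (0 + 1)
    simp only [map_add, PowerSeries.coeff_C_mul, PowerSeries.coeff_succ_X_mul,
      PowerSeries.coeff_zero_X_mul, coeff_tailSeries_zero, coeff_tailSeries_succ,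
      PowerSeries.coeff_X] at this
    norm_num at this
    exact this.symm
  · have := hc (0 + 1 + 1)
    simp only [map_add, PowerSeries.coeff_C_mul, PowerSeries.coeff_succ_X_mul,
      coeff_tailSeries_zero, coeff_tailSeries_succ,
      PowerSeries.coeff_X] at this
    norm_num at this
    linear_combination -this
  · have := hc (n + 1 + 1 + 1)
    simp only [map_add, PowerSeries.coeff_C_mul, PowerSeries.coeff_succ_X_mul,
      coeff_tailSeries_succ, PowerSeries.coeff_X] at this
    norm_num at this
    linear_combination -this

/-- Tomimatsu–Sato with δ = 2. -/
theorem stmt16 (M a : ℂ) (m : ℕ → ℂ)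
    (hm0 : m 0 = M)
    (hm1 : m 1 = Complex.I * a * M)
    (hm2 : m 2 = -M * (3 * a ^ 2 + M ^ 2) / 4)
    (hm3 : m 3 = -(Complex.I * a * M * (a ^ 2 + M ^ 2)) / 2)
    (hm4 : m 4 = (5 * a ^ 4 * M + 10 * a ^ 2 * M ^ 3 + M ^ 5) / 16)
    (hm5 : m 5 = Complex.I * (3 * a ^ 5 * M + 10 * a ^ 3 * M ^ 3 + 3 * a * M ^ 5) / 16) :
    ((Lmat 2 m).det = m 1 ^ 2 - m 0 * m 2 ∧
     (Lmat 2 m).det = (M ^ 4 - a ^ 2 * M ^ 2) / 4) ∧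
    (M ^ 2 * (M ^ 2 - a ^ 2) ≠ 0 →
      ∀ (P R : Polynomial ℂ),
        P = X ^ 2 - Polynomial.C (M + Complex.I * a) * X + Polynomial.C ((M ^ 2 - a ^ 2) / 4) →
        R = X ^ 2 + Polynomial.C (M - Complex.I * a) * X + Polynomial.C ((M ^ 2 - a ^ 2) / 4) →
        ∀ mt : ℕ → ℂ,
          (((reflect 2 R : Polynomial ℂ) : PowerSeries ℂ) - ((reflect 2 P : Polynomial ℂ) : PowerSeries ℂ)
            = (((reflect 2 R : Polynomial ℂ) : PowerSeries ℂ)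
                + ((reflect 2 P : Polynomial ℂ) : PowerSeries ℂ)) * tailSeries mt) →
          ∀ k ≤ 5, mt k = m k) := by
  refine ⟨⟨?_, ?_⟩, ?_⟩
  · simp [Lmat, Matrix.det_fin_two]
    ring
  · simp [Lmat, Matrix.det_fin_two, hm0, hm1, hm2]
    linear_combination a ^ 2 * M ^ 2 * Complex.I_sq
  · intro _ P R hP hR mt h
    have hP' : P = X ^ 2 + Polynomial.C (-(M + Complex.I * a)) * X
        + Polynomial.C ((M ^ 2 - a ^ 2) / 4) := by
      rw [hP, Polynomial.C_neg]; ring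
    rw [hP', hR, reflect_two_quadratic, reflect_two_quadratic] at h
    have h2 : (2 : PowerSeries ℂ) ≠ 0 := fun h =>
      two_ne_zero ((map_ofNat PowerSeries.constantCoeff 2).symm.trans
        ((congrArg PowerSeries.constantCoeff h).trans (map_zero _)))
    obtain ⟨h0, h1, hrec⟩ := tailSeries_recurrence (M := M) (b := -(Complex.I * a))
      (c := (M ^ 2 - a ^ 2) / 4) (m := mt) (by
        apply mul_left_cancel₀ h2
        simp only [Polynomial.coe_add, Polynomial.coe_mul, Polynomial.coe_pow,
          Polynomial.coe_one, Polynomial.coe_C, Polynomial.coe_X] at h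
        simp only [map_neg, map_add, map_sub] at h ⊢
        linear_combination h)
    have e1 : mt 1 = m 1 := by rw [h1, h0, hm1]; ring
    have e2 : mt 2 = m 2 := by
      rw [hrec 0, e1, h0, hm1, hm2]
      linear_combination a ^ 2 * M * Complex.I_sq
    have e3 : mt 3 = m 3 := by
      rw [hrec 1, e2, e1, hm1, hm2, hm3]
      ring
    have e4 : mt 4 = m 4 := by
      rw [hrec 2, e3, e2, hm2, hm3, hm4]
      linear_combination (-(a ^ 2 * M * (a ^ 2 + M ^ 2)) / 2) * Complex.I_sq
    have e5 : mt 5 = m 5 := by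
      rw [hrec 3, e4, e3, hm3, hm4, hm5]
      ring
    intro k hk
    interval_cases k
    exacts [h0.trans hm0.symm, e1, e2, e3, e4, e5]
end
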